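/- For every subset I ⊆ {1,…,n} and every η ∈ W = ker V*, the composition of the operators U_i over i ∈ I (taken in increasing order of indices) satisfies (∘_{i∈I} U_i) η = P_W((∏_{i∈I} V_i) η) + (∏_{i∈I^c} V_i*) η, where I^c = {1,…,n} \ I and an empty product of operators is the identity. -/

import Mathlib

open ContinuousLinearMap Filter Finset

/-- Product of the commuting operators `V i` over a finite index set `s`. -/
noncomputable def opProd {H : Type*} [NormedAddCommGroup H] [InnerProductSpace ℂ H]
    {n : ℕ} (V : Fin n → H →L[ℂ] H) (hcomm : ∀ i j, Commute (V i) (V j))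
    (s : Finset (Fin n)) : H →L[ℂ] H :=
  s.noncommProd V fun a _ b _ _ => hcomm a b

/-- The wandering subspace `ker ((∏_{i ∈ s} V i)^*)`. -/
noncomputable def wSub {H : Type*} [NormedAddCommGroup H] [InnerProductSpace ℂ H] [CompleteSpace H]
    {n : ℕ} (V : Fin n → H →L[ℂ] H) (hcomm : ∀ i j, Commute (V i) (V j))
    (s : Finset (Fin n)) : Submodule ℂ H :=
  LinearMap.ker (ContinuousLinearMap.adjoint (opProd V hcomm s)).toLinearMap

/-- The orthogonal projection of `H` onto `wSub V hcomm s`, as an operator on `H`. -/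
noncomputable def wProj {H : Type*} [NormedAddCommGroup H] [InnerProductSpace ℂ H] [CompleteSpace H]
    {n : ℕ} (V : Fin n → H →L[ℂ] H) (hcomm : ∀ i j, Commute (V i) (V j))
    (s : Finset (Fin n)) : H →L[ℂ] H :=
  haveI : CompleteSpace (wSub V hcomm s) :=
    (ContinuousLinearMap.isClosed_ker _).completeSpace_coe
  (wSub V hcomm s).subtypeL ∘L Submodule.orthogonalProjectionOnto (wSub V hcomm s)

/-- The operator `U_i = P_W ∘ V_i + Ṽ_i^*`, which restricts to a unitary on `W`. -/
noncomputable def Uop {H : Type*} [NormedAddCommGroup H] [InnerProductSpace ℂ H] [CompleteSpace H]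
    {n : ℕ} (V : Fin n → H →L[ℂ] H) (hcomm : ∀ i j, Commute (V i) (V j))
    (i : Fin n) : H →L[ℂ] H :=
  (wProj V hcomm Finset.univ) ∘L V i
    + ContinuousLinearMap.adjoint (opProd V hcomm (Finset.univ.erase i))

section Helpers

variable {H : Type*} [NormedAddCommGroup H] [InnerProductSpace ℂ H]
  {n : ℕ} (V : Fin n → H →L[ℂ] H) (hcomm : ∀ i j, Commute (V i) (V j))

lemma opProd_empty : opProd V hcomm ∅ = 1 :=
  Finset.noncommProd_empty _ _

lemma opProd_insert {s : Finset (Fin n)} {i : Fin n} (hi : i ∉ s) :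
    opProd V hcomm (insert i s) = V i * opProd V hcomm s :=
  Finset.noncommProd_insert_of_notMem _ _ _ _ hi

lemma opProd_mul_of_disjoint {s t : Finset (Fin n)} (h : Disjoint s t) :
    opProd V hcomm (s ∪ t) = opProd V hcomm s * opProd V hcomm t :=
  Finset.noncommProd_union_of_disjoint h _ _

lemma norm_opProd_apply (hiso : ∀ i x, ‖V i x‖ = ‖x‖) (s : Finset (Fin n)) (x : H) :
    ‖opProd V hcomm s x‖ = ‖x‖ := by
  induction s using Finset.induction_on with
  | empty => simp [opProd_empty]
  | insert i s hi ih => rw [opProd_insert V hcomm hi, mul_apply_eq_comp, hiso, ih]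

variable [CompleteSpace H]

lemma adjoint_mul_apply (S T : H →L[ℂ] H) (x : H) :
    adjoint (S * T) x = adjoint T (adjoint S x) := by
  rw [ContinuousLinearMap.mul_def, adjoint_comp, comp_apply]

lemma adjoint_apply_self_of_norm_map {T : H →L[ℂ] H} (hT : ∀ x, ‖T x‖ = ‖x‖) (x : H) :
    adjoint T (T x) = x :=
  DFunLike.congr_fun ((norm_map_iff_adjoint_comp_self T).1 hT) x

lemma wProj_apply (hiso : ∀ i x, ‖V i x‖ = ‖x‖) (s : Finset (Fin n)) (x : H) :
    wProj V hcomm s x = x - opProd V hcomm s (adjoint (opProd V hcomm s) x) := by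
  have : CompleteSpace (wSub V hcomm s) :=
    (ContinuousLinearMap.isClosed_ker _).completeSpace_coe
  change (wSub V hcomm s).starProjection x = _
  have h := adjoint_apply_self_of_norm_map (norm_opProd_apply V hcomm hiso s)
  refine (Submodule.eq_starProjection_of_mem_of_inner_eq_zero ?_ fun w hw => ?_)
  · change adjoint (opProd V hcomm s) _ = 0
    rw [map_sub, h, sub_self]
  · rw [sub_sub_cancel, ← adjoint_inner_right, show adjoint (opProd V hcomm s) w = 0 from hw,
      inner_zero_right]

/-- Composing `U_i` with the formula for `J` gives the formula for `insert i J`. -/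
lemma Uop_apply_formula (hiso : ∀ i x, ‖V i x‖ = ‖x‖) {J : Finset (Fin n)} {i : Fin n}
    (hi : i ∉ J) {η : H} (hη : η ∈ wSub V hcomm Finset.univ) :
    Uop V hcomm i (wProj V hcomm Finset.univ (opProd V hcomm J η)
        + adjoint (opProd V hcomm Jᶜ) η)
      = wProj V hcomm Finset.univ (opProd V hcomm (insert i J) η)
        + adjoint (opProd V hcomm (insert i J)ᶜ) η := by
  have hη0 : adjoint (opProd V hcomm Finset.univ) η = 0 := hη
  have hAiso := adjoint_apply_self_of_norm_map (norm_opProd_apply V hcomm hiso J)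
  have hTiso := adjoint_apply_self_of_norm_map
    (norm_opProd_apply V hcomm hiso (Finset.univ.erase i))
  have hWiso := adjoint_apply_self_of_norm_map (norm_opProd_apply V hcomm hiso Finset.univ)
  have hViso := adjoint_apply_self_of_norm_map (hiso i)
  have hdisj : Disjoint J (insert i J)ᶜ := disjoint_compl_right.mono_right
    (Finset.compl_subset_compl.2 (Finset.subset_insert i J))
  have hB : opProd V hcomm Jᶜ = V i * opProd V hcomm (insert i J)ᶜ := by
    rw [← opProd_insert V hcomm (by simp), Finset.compl_insert,
      Finset.insert_erase (Finset.mem_compl.2 hi)]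
  have hT : opProd V hcomm (Finset.univ.erase i)
      = opProd V hcomm J * opProd V hcomm (insert i J)ᶜ := by
    rw [← opProd_mul_of_disjoint V hcomm hdisj]
    congr 1
    ext j
    by_cases hj : j = i <;> simp [hj, hi, em]
  have hT' : opProd V hcomm (Finset.univ.erase i)
      = opProd V hcomm (insert i J)ᶜ * opProd V hcomm J := by
    rw [hT, ← opProd_mul_of_disjoint V hcomm hdisj, Finset.union_comm,
      opProd_mul_of_disjoint V hcomm hdisj.symm]
  have hW : opProd V hcomm Finset.univ = V i * opProd V hcomm (Finset.univ.erase i) := by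
    rw [← opProd_insert V hcomm (by simp), Finset.insert_erase (Finset.mem_univ i)]
  have hcommV (s : Finset (Fin n)) : V i * opProd V hcomm s = opProd V hcomm s * V i :=
    Finset.noncommProd_commute _ _ _ _ fun _ _ => hcomm _ _
  simp only [Uop, add_apply, comp_apply, opProd_insert V hcomm hi, wProj_apply V hcomm hiso,
    mul_apply_eq_comp]
  have hVW := hcommV Finset.univ
  have hW' := hW.trans (hcommV _)
  have hVC := hcommV (insert i J)ᶜ
  set A := opProd V hcomm J
  set C := opProd V hcomm (insert i J)ᶜ
  set T := opProd V hcomm (Finset.univ.erase i)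
  set W := opProd V hcomm Finset.univ
  set B := opProd V hcomm Jᶜ
  have hBη : adjoint B η = adjoint (V i) (adjoint C η) := by
    rw [hB, hVC, adjoint_mul_apply]
  have hWV (x : H) : adjoint W (V i x) = adjoint T x := by
    rw [hW, adjoint_mul_apply, hViso]
  have hWA : adjoint W (A η) = adjoint B η := by
    have hWB : W = A * B := by rw [hW', hT, hB, hVC, mul_assoc]
    rw [hWB, adjoint_mul_apply, hAiso]
  have hTA : adjoint T (A η) = adjoint C η := by
    rw [hT, adjoint_mul_apply, hAiso]
  have hTW (x : H) : adjoint T (W x) = V i x := by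
    rw [hW', mul_apply_eq_comp, hTiso]
  have hTB : adjoint T (adjoint B η) = 0 := by
    have hBT : B * T = C * W := by rw [hB, hVC, hW, mul_assoc]
    have hCW : C * W = W * C := by
      rw [hW, ← mul_assoc, ← hVC, mul_assoc, mul_assoc]
      congr 1
      rw [hT', mul_assoc, ← hT', hT]
    rw [← adjoint_mul_apply, hBT, hCW, adjoint_mul_apply, hη0, map_zero]
  have hVWx (x : H) : V i (W x) = W (V i x) := DFunLike.congr_fun hVW x
  simp only [hWA, hWV, map_add, map_sub, hTA, hTW, hTB, hVWx, hWiso, map_zero]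
  rw [hBη]
  abel

/-- The formula for the product of the `U_i` along any list of distinct indices. -/
lemma prod_map_Uop_apply (hiso : ∀ i x, ‖V i x‖ = ‖x‖) {l : List (Fin n)} (hl : l.Nodup)
    {η : H} (hη : η ∈ wSub V hcomm Finset.univ) :
    (l.map (Uop V hcomm)).prod η
      = wProj V hcomm Finset.univ (opProd V hcomm l.toFinset η)
        + adjoint (opProd V hcomm l.toFinsetᶜ) η := by
  induction l with
  | nil =>
    have hη0 : adjoint (opProd V hcomm Finset.univ) η = 0 := hη
    simp [wProj_apply V hcomm hiso, opProd_empty, hη0]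
  | cons i l ih =>
    obtain ⟨hi, hl⟩ := List.nodup_cons.1 hl
    rw [List.map_cons, List.prod_cons, mul_apply_eq_comp, ih hl, List.toFinset_cons,
      Uop_apply_formula V hcomm hiso (by simpa using hi) hη]

end Helpers

/-- For every `I ⊆ {1,…,n}` and `η ∈ W`, the composition of the `U_i` over `i ∈ I`
(in increasing order of indices) satisfies
`(∘_{i∈I} U_i) η = P_W((∏_{i∈I} V_i) η) + (∏_{i∈I^c} V_i^*) η`. -/
theorem stmt5 {H : Type*} [NormedAddCommGroup H] [InnerProductSpace ℂ H] [CompleteSpace H]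
    {n : ℕ} (hn : 2 ≤ n) (V : Fin n → H →L[ℂ] H)
    (hiso : ∀ i x, ‖V i x‖ = ‖x‖) (hcomm : ∀ i j, Commute (V i) (V j))
    (hshift : ∀ x : H,
      Tendsto (fun m : ℕ => ((ContinuousLinearMap.adjoint (opProd V hcomm Finset.univ)) ^ m) x)
        atTop (nhds 0))
    (I : Finset (Fin n)) (η : H) (hη : η ∈ wSub V hcomm Finset.univ) :
    ((I.sort (· ≤ ·)).map (Uop V hcomm)).prod η
      = wProj V hcomm Finset.univ (opProd V hcomm I η)
        + ContinuousLinearMap.adjoint (opProd V hcomm Iᶜ) η := by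
  simpa using prod_map_Uop_apply V hcomm hiso (I.sort_nodup (· ≤ ·)) hη
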